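/- For every δ in the cone C one has ‖M_X δ‖₂ ≥ ‖δ‖₂ · (1 − 4√K · √(‖α‖₀/n) · ‖X‖_∞ · (Σ_{k=1}^K ‖X_k‖₂/√n) · ‖(XᵀX/n)^{-1}‖_op), where X_k denotes the k-th column of X. Consequently, the compatibility constant satisfies κ ≥ √2 · (1 − 4√K · √(‖α‖₀/n) · ‖X‖_∞ · (Σ_{k=1}^K ‖X_k‖₂/√n) · ‖(XᵀX/n)^{-1}‖_op). -/

import Mathlib

open MeasureTheory ProbabilityTheory Filter Matrix
open scoped Topology BigOperators NNReal BoundedContinuousFunction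

noncomputable section

/-- Euclidean (`ℓ2`) norm of a vector. -/
def l2norm {m : Type*} [Fintype m] (v : m → ℝ) : ℝ := Real.sqrt (∑ i, v i ^ 2)

/-- `ℓ1` norm of a vector. -/
def l1norm {m : Type*} [Fintype m] (v : m → ℝ) : ℝ := ∑ i, |v i|

/-- sup (`ℓ∞`) norm of a vector. -/
def supnorm {m : Type*} [Fintype m] (v : m → ℝ) : ℝ := ⨆ i, |v i|

/-- Entrywise sup norm of a matrix. -/
def matSup {n K : ℕ} (X : Matrix (Fin n) (Fin K) ℝ) : ℝ := ⨆ i, ⨆ k, |X i k|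

/-- Operator (`ℓ2 → ℓ2`) norm of a square matrix. -/
def opNorm {K : ℕ} (M : Matrix (Fin K) (Fin K) ℝ) : ℝ :=
  ⨆ v : Fin K → ℝ, l2norm (M.mulVec v) / l2norm v

/-- `P_X v = X (XᵀX)⁻¹ Xᵀ v` : projection onto the column space of `X`. -/
def projF {n K : ℕ} (X : Matrix (Fin n) (Fin K) ℝ) (v : Fin n → ℝ) : Fin n → ℝ :=
  X.mulVec ((Xᵀ * X)⁻¹.mulVec (Xᵀ.mulVec v))

/-- `M_X v = v - P_X v`. -/
def residF {n K : ℕ} (X : Matrix (Fin n) (Fin K) ℝ) (v : Fin n → ℝ) : Fin n → ℝ :=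
  v - projF X v

/-- `δ_J` : the vector agreeing with `δ` on the support of `α` and `0` elsewhere. -/
def suppProj {n : ℕ} (α δ : Fin n → ℝ) : Fin n → ℝ := fun i => if α i ≠ 0 then δ i else 0

/-- `ℓ0` (counting) norm of a vector. -/
def l0norm {n : ℕ} (v : Fin n → ℝ) : ℕ := (Finset.univ.filter fun i => v i ≠ 0).card

/-- The cone `C = {δ : ‖δ_{J^c}‖₁ ≤ 3 ‖δ_J‖₁}`. -/
def coneC {n : ℕ} (α : Fin n → ℝ) : Set (Fin n → ℝ) :=
  {δ | l1norm (δ - suppProj α δ) ≤ 3 * l1norm (suppProj α δ)}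

/-- The compatibility constant `κ = min_{δ ∈ C, δ ≠ 0} √(2‖α‖₀) ‖M_X δ‖₂ / ‖δ_J‖₁`. -/
def compatConst {n K : ℕ} (X : Matrix (Fin n) (Fin K) ℝ) (α : Fin n → ℝ) : ℝ :=
  sInf {r | ∃ δ ∈ coneC α, δ ≠ 0 ∧
    r = Real.sqrt (2 * l0norm α) * l2norm (residF X δ) / l1norm (suppProj α δ)}

theorem l2norm_eq_norm {m : Type*} [Fintype m] (v : m → ℝ) : l2norm v = ‖WithLp.toLp 2 v‖ := by
  simp [l2norm, EuclideanSpace.norm_eq]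

theorem l2norm_nonneg {m : Type*} [Fintype m] (v : m → ℝ) : 0 ≤ l2norm v := Real.sqrt_nonneg _

theorem l2norm_sq {m : Type*} [Fintype m] (v : m → ℝ) : l2norm v ^ 2 = ∑ i, v i ^ 2 :=
  Real.sq_sqrt (Finset.sum_nonneg fun _ _ => sq_nonneg _)

theorem abs_le_l2norm {m : Type*} [Fintype m] (v : m → ℝ) (i : m) : |v i| ≤ l2norm v := by
  refine Real.abs_le_sqrt ?_
  exact Finset.single_le_sum (f := fun i => v i ^ 2) (fun _ _ => sq_nonneg _) (Finset.mem_univ i)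

theorem l2norm_smul {m : Type*} [Fintype m] (c : ℝ) (v : m → ℝ) :
    l2norm (c • v) = |c| * l2norm v := by
  rw [l2norm_eq_norm, l2norm_eq_norm, WithLp.toLp_smul, norm_smul, Real.norm_eq_abs]

theorem l2norm_sub_le_l2norm_sub {m : Type*} [Fintype m] (v w : m → ℝ) :
    l2norm v - l2norm w ≤ l2norm (v - w) := by
  simp only [l2norm_eq_norm, WithLp.toLp_sub]
  exact norm_sub_norm_le _ _

theorem l2norm_le_sqrt_card_mul {m : Type*} [Fintype m] {v : m → ℝ} {c : ℝ} (hc : 0 ≤ c)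
    (h : ∀ i, |v i| ≤ c) : l2norm v ≤ √(Fintype.card m) * c := by
  refine (Real.sqrt_le_left (by positivity)).mpr ?_
  rw [mul_pow, Real.sq_sqrt (Nat.cast_nonneg _)]
  calc ∑ i, v i ^ 2 ≤ ∑ _i : m, c ^ 2 :=
        Finset.sum_le_sum fun i _ => sq_le_sq.mpr ((h i).trans (le_abs_self c))
    _ = _ := by simp

theorem l2norm_mulVec_le_sum {m k : Type*} [Fintype m] [Fintype k] (A : Matrix m k ℝ)
    (b : k → ℝ) : l2norm (A.mulVec b) ≤ ∑ j, l2norm (fun i => A i j) * |b j| := by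
  have h : A.mulVec b = ∑ j, b j • fun i => A i j := by
    ext i
    simp [Matrix.mulVec, dotProduct, mul_comm]
  rw [h, l2norm_eq_norm, WithLp.toLp_sum]
  refine (norm_sum_le _ _).trans (Finset.sum_le_sum fun j _ => ?_)
  rw [← l2norm_eq_norm, l2norm_smul, mul_comm]

theorem l2norm_mulVec_le_sum_mul {m k : Type*} [Fintype m] [Fintype k] (A : Matrix m k ℝ)
    (b : k → ℝ) : l2norm (A.mulVec b) ≤ (∑ j, l2norm (fun i => A i j)) * l2norm b := by
  rw [Finset.sum_mul]
  refine (l2norm_mulVec_le_sum A b).trans (Finset.sum_le_sum fun j _ => ?_)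
  exact mul_le_mul_of_nonneg_left (abs_le_l2norm b j) (l2norm_nonneg _)

theorem opNorm_nonneg {K : ℕ} (M : Matrix (Fin K) (Fin K) ℝ) : 0 ≤ opNorm M :=
  Real.iSup_nonneg fun _ => div_nonneg (l2norm_nonneg _) (l2norm_nonneg _)

theorem l2norm_mulVec_le_opNorm_mul {K : ℕ} (M : Matrix (Fin K) (Fin K) ℝ) (v : Fin K → ℝ) :
    l2norm (M.mulVec v) ≤ opNorm M * l2norm v := by
  have hS : 0 ≤ ∑ j, l2norm (fun i => M i j) := Finset.sum_nonneg fun _ _ => l2norm_nonneg _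
  rcases (l2norm_nonneg v).eq_or_lt with h | h
  · have := l2norm_mulVec_le_sum_mul M v
    rw [← h, mul_zero] at this ⊢
    exact this
  · rw [← div_le_iff₀ h]
    refine le_ciSup (f := fun v : Fin K → ℝ => l2norm (M.mulVec v) / l2norm v)
      ⟨∑ j, l2norm (fun i => M i j), ?_⟩ v
    rintro _ ⟨w, rfl⟩
    exact div_le_of_le_mul₀ (l2norm_nonneg _) hS (l2norm_mulVec_le_sum_mul M w)

theorem matSup_nonneg {n K : ℕ} (X : Matrix (Fin n) (Fin K) ℝ) : 0 ≤ matSup X :=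
  Real.iSup_nonneg fun _ => Real.iSup_nonneg fun _ => abs_nonneg _

theorem abs_le_matSup {n K : ℕ} (X : Matrix (Fin n) (Fin K) ℝ) (i : Fin n) (k : Fin K) :
    |X i k| ≤ matSup X :=
  (le_ciSup (f := fun k => |X i k|) (Set.finite_range _).bddAbove k).trans
    (le_ciSup (f := fun i => ⨆ k, |X i k|) (Set.finite_range _).bddAbove i)

theorem l1norm_nonneg {m : Type*} [Fintype m] (v : m → ℝ) : 0 ≤ l1norm v :=
  Finset.sum_nonneg fun _ _ => abs_nonneg _

theorem l1norm_eq_zero {m : Type*} [Fintype m] {v : m → ℝ} : l1norm v = 0 ↔ v = 0 := by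
  rw [l1norm, Finset.sum_eq_zero_iff_of_nonneg fun i _ => abs_nonneg (v i)]
  simp [funext_iff]

theorem l2norm_transpose_mulVec_le {n K : ℕ} (X : Matrix (Fin n) (Fin K) ℝ) (δ : Fin n → ℝ) :
    l2norm (Xᵀ.mulVec δ) ≤ √K * (matSup X * l1norm δ) := by
  have h := l2norm_le_sqrt_card_mul (v := Xᵀ.mulVec δ)
    (mul_nonneg (matSup_nonneg X) (l1norm_nonneg δ)) fun k => ?_
  · simpa using h
  · rw [l1norm, Finset.mul_sum]
    refine (Finset.abs_sum_le_sum_abs (fun i => X i k * δ i) Finset.univ).trans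
      (Finset.sum_le_sum fun i _ => ?_)
    rw [abs_mul]
    exact mul_le_mul_of_nonneg_right (abs_le_matSup X i k) (abs_nonneg _)

theorem l1norm_suppProj_le {n : ℕ} (α δ : Fin n → ℝ) :
    l1norm (suppProj α δ) ≤ √(l0norm α) * l2norm δ := by
  have h : l1norm (suppProj α δ) = ∑ i with α i ≠ 0, |δ i| := by
    rw [Finset.sum_filter]
    refine Finset.sum_congr rfl fun i _ => ?_
    by_cases hi : α i = 0 <;> simp [suppProj, hi]
  rw [h]
  refine le_of_sq_le_sq ?_ (mul_nonneg (Real.sqrt_nonneg _) (l2norm_nonneg _))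
  rw [mul_pow, Real.sq_sqrt (Nat.cast_nonneg _), l2norm_sq]
  refine sq_sum_le_card_mul_sum_sq.trans (mul_le_mul_of_nonneg_left ?_ (Nat.cast_nonneg _))
  simp only [sq_abs]
  exact Finset.sum_le_sum_of_subset_of_nonneg (Finset.filter_subset _ _) fun _ _ _ => sq_nonneg _

theorem l1norm_le_of_mem_coneC {n : ℕ} {α δ : Fin n → ℝ} (hδ : δ ∈ coneC α) :
    l1norm δ ≤ 4 * l1norm (suppProj α δ) := by
  have h : l1norm δ ≤ l1norm (δ - suppProj α δ) + l1norm (suppProj α δ) := by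
    simp only [l1norm, ← Finset.sum_add_distrib]
    refine Finset.sum_le_sum fun i _ => ?_
    simpa using abs_add_le (δ i - suppProj α δ i) (suppProj α δ i)
  have h' : l1norm (δ - suppProj α δ) ≤ 3 * l1norm (suppProj α δ) := hδ
  linarith

theorem l1norm_suppProj_pos_of_mem_coneC {n : ℕ} {α δ : Fin n → ℝ} (hδ : δ ∈ coneC α)
    (h0 : δ ≠ 0) : 0 < l1norm (suppProj α δ) := by
  have h1 : 0 < l1norm δ := (l1norm_nonneg δ).lt_of_ne' (l1norm_eq_zero.not.mpr h0)
  linarith [l1norm_le_of_mem_coneC hδ]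

theorem self_mem_coneC {n : ℕ} (α : Fin n → ℝ) : α ∈ coneC α := by
  have h : suppProj α α = α := by
    ext i
    simp +contextual [suppProj, eq_comm]
  simp only [coneC, Set.mem_ofPred_eq, h, sub_self, l1norm_eq_zero.mpr]
  exact mul_nonneg (by norm_num) (l1norm_nonneg α)

theorem l2norm_inv_mulVec_le {n K : ℕ} (hn : 1 ≤ n) {A : Matrix (Fin K) (Fin K) ℝ}
    (hA : IsUnit A.det) (u : Fin K → ℝ) :
    l2norm (A⁻¹.mulVec u) ≤ (n : ℝ)⁻¹ * (opNorm ((n : ℝ)⁻¹ • A)⁻¹ * l2norm u) := by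
  have hn' : (0 : ℝ) < n := by exact_mod_cast hn
  have h : ((n : ℝ)⁻¹ • A)⁻¹ = (n : ℝ) • A⁻¹ := by
    refine Matrix.inv_eq_right_inv ?_
    rw [Matrix.smul_mul, Matrix.mul_smul, smul_smul, inv_mul_cancel₀ hn'.ne', one_smul,
      Matrix.mul_nonsing_inv A hA]
  have h' := l2norm_mulVec_le_opNorm_mul ((n : ℝ)⁻¹ • A)⁻¹ u
  rw [le_inv_mul_iff₀ hn']
  refine le_trans (le_of_eq ?_) h'
  rw [h, Matrix.smul_mulVec, l2norm_smul, abs_of_pos hn']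

theorem l2norm_projF_le {n K : ℕ} (hn : 1 ≤ n) (X : Matrix (Fin n) (Fin K) ℝ)
    (hinv : IsUnit (Xᵀ * X).det) {α δ : Fin n → ℝ} (hδ : δ ∈ coneC α) :
    l2norm (projF X δ) ≤ l2norm δ * (4 * √K * √((l0norm α : ℝ) / n) * matSup X *
      (∑ k, l2norm (fun i => X i k) / √n) * opNorm ((n : ℝ)⁻¹ • (Xᵀ * X))⁻¹) := by
  have hn' : (0 : ℝ) < n := by exact_mod_cast hn
  have hS : 0 ≤ ∑ k, l2norm (fun i => X i k) := Finset.sum_nonneg fun _ _ => l2norm_nonneg _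
  have hO := opNorm_nonneg ((n : ℝ)⁻¹ • (Xᵀ * X))⁻¹
  have hM := matSup_nonneg X
  have hδ₁ : l1norm δ ≤ 4 * (√(l0norm α) * l2norm δ) :=
    (l1norm_le_of_mem_coneC hδ).trans (by gcongr; exact l1norm_suppProj_le α δ)
  calc l2norm (projF X δ)
      ≤ (∑ k, l2norm (fun i => X i k)) * l2norm ((Xᵀ * X)⁻¹.mulVec (Xᵀ.mulVec δ)) :=
        l2norm_mulVec_le_sum_mul X _
    _ ≤ (∑ k, l2norm (fun i => X i k)) * ((n : ℝ)⁻¹ * (opNorm ((n : ℝ)⁻¹ • (Xᵀ * X))⁻¹ *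
          l2norm (Xᵀ.mulVec δ))) := by
        gcongr
        exact l2norm_inv_mulVec_le hn hinv _
    _ ≤ (∑ k, l2norm (fun i => X i k)) * ((n : ℝ)⁻¹ * (opNorm ((n : ℝ)⁻¹ • (Xᵀ * X))⁻¹ *
          (√K * (matSup X * (4 * (√(l0norm α) * l2norm δ)))))) := by
        gcongr
        exact (l2norm_transpose_mulVec_le X δ).trans (by gcongr)
    _ = _ := by
        have hs : (n : ℝ)⁻¹ = (√n)⁻¹ * (√n)⁻¹ := by
          rw [← mul_inv, Real.mul_self_sqrt hn'.le]
        rw [← Finset.sum_div, Real.sqrt_div (Nat.cast_nonneg _), div_eq_mul_inv, div_eq_mul_inv]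
        nth_rewrite 1 [hs]
        ring

theorem l2norm_mul_one_sub_le_l2norm_residF {n K : ℕ} (hn : 1 ≤ n) (X : Matrix (Fin n) (Fin K) ℝ)
    (hinv : IsUnit (Xᵀ * X).det) {α δ : Fin n → ℝ} (hδ : δ ∈ coneC α) :
    l2norm δ * (1 - 4 * √K * √((l0norm α : ℝ) / n) * matSup X *
      (∑ k, l2norm (fun i => X i k) / √n) * opNorm ((n : ℝ)⁻¹ • (Xᵀ * X))⁻¹) ≤
        l2norm (residF X δ) := by
  rw [mul_sub, mul_one]
  exact (sub_le_sub_left (l2norm_projF_le hn X hinv hδ) _).trans (l2norm_sub_le_l2norm_sub _ _)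

theorem sqrt_two_mul_le_compatConst {n K : ℕ} (X : Matrix (Fin n) (Fin K) ℝ) {α : Fin n → ℝ}
    (hα : α ≠ 0) {c : ℝ} (hc : ∀ δ ∈ coneC α, l2norm δ * c ≤ l2norm (residF X δ)) :
    √2 * c ≤ compatConst X α := by
  refine le_csInf ⟨_, α, self_mem_coneC α, hα, rfl⟩ ?_
  rintro _ ⟨δ, hδ, h0, rfl⟩
  have hpos := l1norm_suppProj_pos_of_mem_coneC hδ h0
  have hr := l2norm_nonneg (residF X δ)
  rcases le_total c 0 with h | h
  · exact (mul_nonpos_of_nonneg_of_nonpos (Real.sqrt_nonneg _) h).trans (by positivity)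
  · rw [le_div_iff₀ hpos, Real.sqrt_mul (by norm_num), mul_assoc, mul_assoc]
    refine mul_le_mul_of_nonneg_left ?_ (Real.sqrt_nonneg _)
    calc c * l1norm (suppProj α δ) ≤ c * (√(l0norm α) * l2norm δ) := by
          gcongr
          exact l1norm_suppProj_le α δ
      _ = √(l0norm α) * (l2norm δ * c) := by ring
      _ ≤ _ := by
          gcongr
          exact hc δ hδ

/-- for every `δ` in the cone `C`,
`‖M_X δ‖₂ ≥ ‖δ‖₂ (1 - 4√K √(‖α‖₀/n) ‖X‖_∞ (∑ₖ ‖X_k‖₂/√n) ‖(XᵀX/n)⁻¹‖_op)`, and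
consequently `κ ≥ √2 (1 - 4√K √(‖α‖₀/n) ‖X‖_∞ (∑ₖ ‖X_k‖₂/√n) ‖(XᵀX/n)⁻¹‖_op)`. -/
theorem statement7 {n K : ℕ} (hn : 1 ≤ n) (hK : 1 ≤ K)
    (X : Matrix (Fin n) (Fin K) ℝ) (hinv : IsUnit (Xᵀ * X).det)
    (α : Fin n → ℝ) (hα : α ≠ 0) :
    (∀ δ ∈ coneC α,
      l2norm δ * (1 - 4 * Real.sqrt K * Real.sqrt ((l0norm α : ℝ) / n) * matSup X *
        (∑ k, l2norm (fun i => X i k) / Real.sqrt n) * opNorm ((n : ℝ)⁻¹ • (Xᵀ * X))⁻¹) ≤ l2norm (residF X δ)) ∧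
    Real.sqrt 2 * (1 - 4 * Real.sqrt K * Real.sqrt ((l0norm α : ℝ) / n) * matSup X *
        (∑ k, l2norm (fun i => X i k) / Real.sqrt n) * opNorm ((n : ℝ)⁻¹ • (Xᵀ * X))⁻¹) ≤ compatConst X α := by
  have h := fun δ (hδ : δ ∈ coneC α) => l2norm_mul_one_sub_le_l2norm_residF hn X hinv hδ
  exact ⟨h, sqrt_two_mul_le_compatConst X hα h⟩
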